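/- Let (X, Σ, μ) be a finite measure space, T > 0, and let φ : (0,T) × X × ℝ² → ℝ satisfy: (i) φ(t,·,ξ) is measurable for all t ∈ (0,T) and ξ ∈ ℝ², and φ(t,·,0) ∈ L¹(X,μ); (ii) φ(t,x,·) is locally Lipschitz on ℝ² for all t ∈ (0,T), x ∈ X; (iii) there is c > 0 such that every ν ∈ ∂φ(t,x,ξ) satisfies |ν|_{ℝ²} ≤ c(1 + |ξ|_{ℝ²}) for all t, x, ξ. Let Φ(t,U) = ∫_X φ(t, x, U(x)) dμ(x) for U ∈ H := L²(X, μ; ℝ²). Then the Clarke subdifferential of Φ(t,·) satisfies a linear growth condition: there exists c' > 0 such that for all t ∈ (0,T) and V ∈ H, every ξ ∈ ∂Φ(t,V) (an element of H* identified with H) satisfies ‖ξ‖_H ≤ c'(1 + ‖V‖_H). -/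

import Mathlib

open MeasureTheory Filter

/-- The Clarke generalized directional derivative of `ψ` at `x` in direction `v`. -/
noncomputable def clarkeDeriv {E : Type*} [NormedAddCommGroup E] [NormedSpace ℝ E]
    (ψ : E → ℝ) (x v : E) : ℝ :=
  Filter.limsup (fun p : E × ℝ => (ψ (p.1 + p.2 • v) - ψ p.1) / p.2)
    ((nhds x) ×ˢ (nhdsWithin 0 (Set.Ioi (0 : ℝ))))

/-- The Clarke subdifferential `∂ψ(x) = {ξ ∈ E* : ⟨ξ,v⟩ ≤ ψ°(x;v) for all v ∈ E}`. -/
def clarkeSubdiff {E : Type*} [NormedAddCommGroup E] [NormedSpace ℝ E]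
    (ψ : E → ℝ) (x : E) : Set (E →L[ℝ] ℝ) :=
  {ξ | ∀ v : E, ξ v ≤ clarkeDeriv ψ x v}

open Topology NNReal

section ClarkeCalculus

variable {E : Type*} [NormedAddCommGroup E] [NormedSpace ℝ E]

lemma tendsto_fst_add_snd_smul (x v : E) :
    Tendsto (fun p : E × ℝ => p.1 + p.2 • v) (𝓝 x ×ˢ 𝓝[>] (0 : ℝ)) (𝓝 x) := by
  have h : Tendsto (fun p : E × ℝ => p.1 + p.2 • v) (𝓝 x ×ˢ 𝓝 (0 : ℝ)) (𝓝 (x + (0 : ℝ) • v)) :=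
    tendsto_fst.add (tendsto_snd.smul_const v)
  rw [zero_smul, add_zero] at h
  exact h.mono_left (prod_mono le_rfl nhdsWithin_le_nhds)

lemma eventually_snd_pos {E : Type*} [TopologicalSpace E] (x : E) : ∀ᶠ p : E × ℝ in 𝓝 x ×ˢ 𝓝[>] (0 : ℝ), 0 < p.2 :=
  tendsto_snd.eventually self_mem_nhdsWithin

lemma LipschitzOnWith.eventually_abs_quotient_le {ψ : E → ℝ} {x : E} {K : ℝ≥0} {s : Set E}
    (h : LipschitzOnWith K ψ s) (hs : s ∈ 𝓝 x) (v : E) :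
    ∀ᶠ p : E × ℝ in 𝓝 x ×ˢ 𝓝[>] (0 : ℝ), |(ψ (p.1 + p.2 • v) - ψ p.1) / p.2| ≤ K * ‖v‖ := by
  filter_upwards [tendsto_fst.eventually hs, (tendsto_fst_add_snd_smul x v).eventually hs,
    eventually_snd_pos x] with p h₁ h₂ h₃
  rw [abs_div, abs_of_pos h₃, div_le_iff₀ h₃, ← Real.norm_eq_abs]
  refine (h.norm_sub_le h₂ h₁).trans_eq ?_
  rw [add_sub_cancel_left, norm_smul, Real.norm_of_nonneg h₃.le]
  ring

lemma LipschitzOnWith.clarkeDeriv_le {ψ : E → ℝ} {x : E} {K : ℝ≥0} {s : Set E}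
    (h : LipschitzOnWith K ψ s) (hs : s ∈ 𝓝 x) {v : E} {a : ℝ}
    (ha : ∀ᶠ p : E × ℝ in 𝓝 x ×ˢ 𝓝[>] (0 : ℝ), (ψ (p.1 + p.2 • v) - ψ p.1) / p.2 ≤ a) :
    clarkeDeriv ψ x v ≤ a :=
  limsup_le_of_le (IsBoundedUnder.isCoboundedUnder_le (isBoundedUnder_of_eventually_ge
    ((h.eventually_abs_quotient_le hs v).mono fun _ hp => (abs_le.1 hp).1))) ha

lemma LipschitzOnWith.clarkeDeriv_le_mul_norm {ψ : E → ℝ} {x : E} {K : ℝ≥0} {s : Set E}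
    (h : LipschitzOnWith K ψ s) (hs : s ∈ 𝓝 x) (v : E) : clarkeDeriv ψ x v ≤ K * ‖v‖ :=
  h.clarkeDeriv_le hs ((h.eventually_abs_quotient_le hs v).mono fun _ hp => (abs_le.1 hp).2)

namespace LocallyLipschitz

variable {ψ : E → ℝ}

lemma clarkeDeriv_le (h : LocallyLipschitz ψ) {x v : E} {a : ℝ}
    (ha : ∀ᶠ p : E × ℝ in 𝓝 x ×ˢ 𝓝[>] (0 : ℝ), (ψ (p.1 + p.2 • v) - ψ p.1) / p.2 ≤ a) :
    clarkeDeriv ψ x v ≤ a := by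
  obtain ⟨K, s, hs, hK⟩ := h x
  exact hK.clarkeDeriv_le hs ha

lemma eventually_quotient_lt (h : LocallyLipschitz ψ) {x v : E} {a : ℝ}
    (ha : clarkeDeriv ψ x v < a) :
    ∀ᶠ p : E × ℝ in 𝓝 x ×ˢ 𝓝[>] (0 : ℝ), (ψ (p.1 + p.2 • v) - ψ p.1) / p.2 < a := by
  obtain ⟨K, s, hs, hK⟩ := h x
  exact eventually_lt_of_limsup_lt ha (isBoundedUnder_of_eventually_le
    ((hK.eventually_abs_quotient_le hs v).mono fun _ hp => (abs_le.1 hp).2))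

lemma clarkeDeriv_add_le (h : LocallyLipschitz ψ) (x v w : E) :
    clarkeDeriv ψ x (v + w) ≤ clarkeDeriv ψ x v + clarkeDeriv ψ x w := by
  refine le_of_forall_pos_le_add fun ε hε => h.clarkeDeriv_le ?_
  have hv := h.eventually_quotient_lt (lt_add_of_pos_right (clarkeDeriv ψ x v) (half_pos hε))
  have hw := h.eventually_quotient_lt (lt_add_of_pos_right (clarkeDeriv ψ x w) (half_pos hε))
  have hm : Tendsto (fun p : E × ℝ => (p.1 + p.2 • w, p.2)) (𝓝 x ×ˢ 𝓝[>] (0 : ℝ))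
      (𝓝 x ×ˢ 𝓝[>] (0 : ℝ)) := (tendsto_fst_add_snd_smul x w).prodMk tendsto_snd
  filter_upwards [hm.eventually hv, hw] with p h₁ h₂
  have e : p.1 + p.2 • (v + w) = p.1 + p.2 • w + p.2 • v := by rw [smul_add]; abel
  rw [e, ← sub_add_sub_cancel _ (ψ (p.1 + p.2 • w)), add_div]
  linarith

lemma clarkeDeriv_smul_le (h : LocallyLipschitz ψ) {r : ℝ} (hr : 0 < r) (x v : E) :
    clarkeDeriv ψ x (r • v) ≤ r * clarkeDeriv ψ x v := by
  refine le_of_forall_pos_le_add fun ε hε => h.clarkeDeriv_le ?_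
  have hv := h.eventually_quotient_lt
    (lt_add_of_pos_right (clarkeDeriv ψ x v) (div_pos hε hr))
  have hr' : Tendsto (fun l : ℝ => l * r) (𝓝[>] 0) (𝓝[>] 0) := by
    refine tendsto_nhdsWithin_iff.2 ⟨?_, ?_⟩
    · have := (continuous_mul_const r).tendsto (0 : ℝ)
      rw [zero_mul] at this
      exact this.mono_left nhdsWithin_le_nhds
    · filter_upwards [self_mem_nhdsWithin] with l hl using mul_pos hl hr
  have hm : Tendsto (fun p : E × ℝ => (p.1, p.2 * r)) (𝓝 x ×ˢ 𝓝[>] (0 : ℝ))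
      (𝓝 x ×ˢ 𝓝[>] (0 : ℝ)) := tendsto_fst.prodMk (hr'.comp tendsto_snd)
  filter_upwards [hm.eventually hv, eventually_snd_pos x] with p h₁ h₂
  rw [smul_smul]
  rw [div_lt_iff₀ (mul_pos h₂ hr)] at h₁
  rw [div_le_iff₀ h₂]
  refine h₁.le.trans_eq ?_
  field_simp

lemma clarkeDeriv_smul (h : LocallyLipschitz ψ) {r : ℝ} (hr : 0 < r) (x v : E) :
    clarkeDeriv ψ x (r • v) = r * clarkeDeriv ψ x v := by
  refine (h.clarkeDeriv_smul_le hr x v).antisymm ?_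
  have := h.clarkeDeriv_smul_le (inv_pos.2 hr) x (r • v)
  rwa [inv_smul_smul₀ hr.ne', inv_mul_eq_div, le_div_iff₀ hr, mul_comm] at this

lemma clarkeDeriv_zero (h : LocallyLipschitz ψ) (x : E) : clarkeDeriv ψ x 0 = 0 := by
  have := h.clarkeDeriv_smul two_pos x 0
  rw [smul_zero] at this
  linarith

/-- The generalized directional derivative of a locally Lipschitz function is attained by some
element of the Clarke subdifferential. -/
lemma exists_mem_clarkeSubdiff (h : LocallyLipschitz ψ) (x : E) {v : E} (hv : v ≠ 0) :
    ∃ ξ ∈ clarkeSubdiff ψ x, ξ v = clarkeDeriv ψ x v := by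
  obtain ⟨g, hg, hgN⟩ := exists_extension_of_le_sublinear
    (LinearPMap.mkSpanSingleton v (clarkeDeriv ψ x v) hv) (clarkeDeriv ψ x)
    (fun r hr w => h.clarkeDeriv_smul hr x w) (h.clarkeDeriv_add_le x) (by
      rintro ⟨y, hy⟩
      obtain ⟨r, rfl⟩ := Submodule.mem_span_singleton.1 hy
      refine (LinearPMap.mkSpanSingleton'_apply _ _ _ r _).trans_le ?_
      rw [RingHom.id_apply, smul_eq_mul]
      rcases lt_trichotomy r 0 with hr | rfl | hr
      · have h₁ := h.clarkeDeriv_add_le x (r • v) ((-r) • v)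
        rw [← add_smul, add_neg_cancel, zero_smul, h.clarkeDeriv_zero,
          h.clarkeDeriv_smul (neg_pos.2 hr)] at h₁
        linarith
      · simp [h.clarkeDeriv_zero]
      · exact (h.clarkeDeriv_smul hr x v).ge)
  obtain ⟨K, s, hs, hK⟩ := h x
  have hb : ∀ w, ‖g w‖ ≤ K * ‖w‖ := fun w => by
    rw [Real.norm_eq_abs, abs_le]
    have h₁ := (hgN (-w)).trans (hK.clarkeDeriv_le_mul_norm hs (-w))
    rw [map_neg, norm_neg] at h₁
    exact ⟨by linarith, (hgN w).trans (hK.clarkeDeriv_le_mul_norm hs w)⟩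
  refine ⟨g.mkContinuous K hb, fun w => hgN w, ?_⟩
  exact (hg ⟨v, Submodule.mem_span_singleton_self v⟩).trans
    (LinearPMap.mkSpanSingleton_apply ℝ ℝ hv _)

lemma clarkeDeriv_le_of_forall_norm_le (h : LocallyLipschitz ψ) {x : E} {C : ℝ}
    (hC : ∀ ν ∈ clarkeSubdiff ψ x, ‖ν‖ ≤ C) (v : E) : clarkeDeriv ψ x v ≤ C * ‖v‖ := by
  rcases eq_or_ne v 0 with rfl | hv
  · simp [h.clarkeDeriv_zero]
  · obtain ⟨ξ, hξ, hξv⟩ := h.exists_mem_clarkeSubdiff x hv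
    rw [← hξv]
    exact (le_abs_self _).trans (ξ.le_of_opNorm_le (hC ξ hξ) v)

/-- A mean value inequality for the generalized directional derivative. -/
lemma sub_le_of_clarkeDeriv_le (h : LocallyLipschitz ψ) {a b : E} {C : ℝ}
    (hC : ∀ x ∈ segment ℝ a b, clarkeDeriv ψ x (b - a) ≤ C) : ψ b - ψ a ≤ C := by
  have hcont : Continuous fun s : ℝ => ψ (a + s • (b - a)) :=
    h.continuous.comp (by fun_prop)
  have key := image_le_of_liminf_slope_right_le_deriv_boundary
    (f := fun s : ℝ => ψ (a + s • (b - a))) (a := 0) (b := 1)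
    (B := fun s => ψ a + C * s) (B' := fun _ => C) hcont.continuousOn (by simp)
    (by fun_prop)
    (fun s _ => by
      simpa using (((hasDerivAt_id s).const_mul C).const_add (ψ a)).hasDerivWithinAt)
    (fun s hs r hr => by
      have hseg : a + s • (b - a) ∈ segment ℝ a b := by
        rw [segment_eq_image']
        exact ⟨s, ⟨hs.1, hs.2.le⟩, rfl⟩
      have hev := h.eventually_quotient_lt ((hC _ hseg).trans_lt hr)
      have hsub : Tendsto (fun z : ℝ => z - s) (𝓝[>] s) (𝓝[>] 0) := by
        refine tendsto_nhdsWithin_iff.2 ⟨?_, ?_⟩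
        · have := (continuous_sub_right s).tendsto s
          rw [sub_self] at this
          exact this.mono_left nhdsWithin_le_nhds
        · filter_upwards [self_mem_nhdsWithin] with z hz using sub_pos.2 (Set.mem_Ioi.1 hz)
      have hm : Tendsto (fun z : ℝ => (a + s • (b - a), z - s)) (𝓝[>] s)
          (𝓝 (a + s • (b - a)) ×ˢ 𝓝[>] (0 : ℝ)) := tendsto_const_nhds.prodMk hsub
      refine ((hm.eventually hev).mono fun z hz => ?_).frequently
      rw [slope_def_field]
      have e : a + s • (b - a) + (z - s) • (b - a) = a + z • (b - a) := by
        rw [sub_smul]; abel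
      simpa only [e] using hz)
    (Set.right_mem_Icc.2 zero_le_one)
  simp only [one_smul, add_sub_cancel, mul_one] at key
  linarith

lemma abs_sub_le_of_clarkeSubdiff_growth (h : LocallyLipschitz ψ) {c : ℝ} (hc : 0 ≤ c)
    (hgrowth : ∀ x, ∀ ν ∈ clarkeSubdiff ψ x, ‖ν‖ ≤ c * (1 + ‖x‖)) (a b : E) :
    |ψ a - ψ b| ≤ c * (1 + ‖a‖ + ‖b‖) * ‖a - b‖ := by
  have key : ∀ a b : E, ψ b - ψ a ≤ c * (1 + ‖a‖ + ‖b‖) * ‖b - a‖ := fun a b => by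
    refine h.sub_le_of_clarkeDeriv_le fun x hx =>
      h.clarkeDeriv_le_of_forall_norm_le (fun ν hν => (hgrowth x ν hν).trans ?_) (b - a)
    have hx' : ‖x‖ ≤ max ‖a‖ ‖b‖ :=
      (convexOn_norm convex_univ).le_on_segment (Set.mem_univ a) (Set.mem_univ b) hx
    have : max ‖a‖ ‖b‖ ≤ ‖a‖ + ‖b‖ := max_le_add_of_nonneg (norm_nonneg a) (norm_nonneg b)
    exact mul_le_mul_of_nonneg_left (by linarith) hc
  rw [abs_sub_le_iff]
  refine ⟨(key b a).trans_eq (by ring), (key a b).trans_eq ?_⟩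
  rw [norm_sub_rev]

end LocallyLipschitz

end ClarkeCalculus

section IntegralFunctional

variable {X : Type*} [MeasurableSpace X] {μ : Measure X}

lemma integral_mul_le_norm_toLp_mul_norm_toLp {f g : X → ℝ} (hf : MemLp f 2 μ)
    (hg : MemLp g 2 μ) : ∫ x, f x * g x ∂μ ≤ ‖hf.toLp f‖ * ‖hg.toLp g‖ := by
  refine le_trans (le_of_eq ?_) (real_inner_le_norm (hf.toLp f) (hg.toLp g))
  rw [L2.inner_def]
  refine integral_congr_ae ?_
  filter_upwards [hf.coeFn_toLp, hg.coeFn_toLp] with x h₁ h₂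
  simp [h₁, h₂, mul_comm]

variable [IsFiniteMeasure μ] {F : Type*} [NormedAddCommGroup F]

/-- An integrand which is Lipschitz with linearly growing constant induces an integral functional
on `L²` which is Lipschitz with linearly growing constant. -/
lemma abs_integral_comp_sub_le [MeasurableSpace F] [BorelSpace F] [SecondCountableTopology F]
    {φ : X → F → ℝ} {c : ℝ} (hc : 0 ≤ c)
    (h_meas : ∀ ξ, Measurable fun x => φ x ξ) (h_zero : Integrable (fun x => φ x 0) μ)
    (h_cont : ∀ x, Continuous (φ x))
    (h : ∀ x a b, |φ x a - φ x b| ≤ c * (1 + ‖a‖ + ‖b‖) * ‖a - b‖) (U V : Lp F 2 μ) :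
    |∫ x, φ x (U x) ∂μ - ∫ x, φ x (V x) ∂μ| ≤
      c * (‖Lp.const 2 μ (1 : ℝ)‖ + ‖U‖ + ‖V‖) * ‖U - V‖ := by
  have hG : ∀ U V : Lp F 2 μ, MemLp (fun x => 1 + ‖U x‖ + ‖V x‖) 2 μ := fun U V =>
    ((memLp_const (1 : ℝ)).add (Lp.memLp U).norm).add (Lp.memLp V).norm
  have hD : ∀ U V : Lp F 2 μ, MemLp (fun x => ‖U x - V x‖) 2 μ := fun U V =>
    ((Lp.memLp U).sub (Lp.memLp V)).norm
  have hGD : ∀ U V : Lp F 2 μ,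
      Integrable (fun x => (1 + ‖U x‖ + ‖V x‖) * ‖U x - V x‖) μ := fun U V =>
    (hG U V).integrable_mul (hD U V)
  have hunc : Measurable (Function.uncurry fun (ξ : F) (x : X) => φ x ξ) :=
    measurable_uncurry_of_continuous_of_measurable h_cont h_meas
  have hmeas : ∀ U : Lp F 2 μ, AEStronglyMeasurable (fun x => φ x (U x)) μ := fun U =>
    (hunc.comp ((Lp.stronglyMeasurable U).measurable.prodMk measurable_id)).aestronglyMeasurable
  have hint : ∀ U : Lp F 2 μ, Integrable (fun x => φ x (U x)) μ := fun U => by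
    refine Integrable.mono' (h_zero.abs.add ((hGD U 0).const_mul c)) (hmeas U) ?_
    filter_upwards [Lp.coeFn_zero F 2 μ] with x hx
    have := h x (U x) 0
    simp only [Pi.add_apply, hx, Pi.zero_apply, Real.norm_eq_abs]
    have := abs_sub_abs_le_abs_sub (φ x (U x)) (φ x 0)
    linarith
  have hnormG : ‖(hG U V).toLp‖ ≤ ‖Lp.const 2 μ (1 : ℝ)‖ + ‖U‖ + ‖V‖ := by
    have e : (hG U V).toLp = Lp.const 2 μ (1 : ℝ) + (Lp.memLp U).norm.toLp
        + (Lp.memLp V).norm.toLp := rfl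
    rw [e]
    refine (norm_add₃_le).trans_eq ?_
    rw [Lp.norm_toLp, Lp.norm_toLp, eLpNorm_norm, eLpNorm_norm, ← Lp.norm_def, ← Lp.norm_def]
  have hnormD : ‖(hD U V).toLp‖ = ‖U - V‖ := by
    rw [Lp.norm_toLp, eLpNorm_norm, Lp.norm_def]
    exact congrArg _ (eLpNorm_congr_ae (Lp.coeFn_sub U V).symm)
  rw [← integral_sub (hint U) (hint V)]
  calc |∫ x, φ x (U x) - φ x (V x) ∂μ|
      ≤ ∫ x, |φ x (U x) - φ x (V x)| ∂μ := abs_integral_le_integral_abs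
    _ ≤ ∫ x, c * ((1 + ‖U x‖ + ‖V x‖) * ‖U x - V x‖) ∂μ :=
        integral_mono ((hint U).sub (hint V)).abs ((hGD U V).const_mul c)
          fun x => (h x (U x) (V x)).trans_eq (mul_assoc _ _ _)
    _ = c * ∫ x, (1 + ‖U x‖ + ‖V x‖) * ‖U x - V x‖ ∂μ := integral_const_mul _ _
    _ ≤ c * (‖(hG U V).toLp‖ * ‖(hD U V).toLp‖) := by
        gcongr
        exact integral_mul_le_norm_toLp_mul_norm_toLp (hG U V) (hD U V)
    _ ≤ c * ((‖Lp.const 2 μ (1 : ℝ)‖ + ‖U‖ + ‖V‖) * ‖U - V‖) := by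
        rw [hnormD]
        gcongr
    _ = _ := (mul_assoc _ _ _).symm

end IntegralFunctional

lemma norm_le_of_mem_clarkeSubdiff {E : Type*} [NormedAddCommGroup E] [NormedSpace ℝ E]
    {Ψ : E → ℝ} {c m : ℝ} (hc : 0 ≤ c) (hm : 0 ≤ m)
    (h : ∀ U W, |Ψ U - Ψ W| ≤ c * (m + ‖U‖ + ‖W‖) * ‖U - W‖) {V : E} {ξ : E →L[ℝ] ℝ}
    (hξ : ξ ∈ clarkeSubdiff Ψ V) : ‖ξ‖ ≤ c * (m + 2) * (1 + ‖V‖) := by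
  have hK : 0 ≤ c * (m + 2) * (1 + ‖V‖) := by positivity
  have hL : LipschitzOnWith (NNReal.mk _ hK) Ψ (Metric.ball V 1) := by
    refine LipschitzOnWith.of_dist_le_mul fun U hU W hW => ?_
    rw [Real.dist_eq, dist_eq_norm]
    refine (h U W).trans ?_
    have hball : ∀ U ∈ Metric.ball V 1, ‖U‖ ≤ 1 + ‖V‖ := fun U hU => by
      rw [mem_ball_iff_norm] at hU
      have := norm_le_norm_add_norm_sub' U V
      linarith
    have hU' := hball U hU
    have hW' := hball W hW
    refine mul_le_mul_of_nonneg_right ?_ (norm_nonneg _)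
    rw [NNReal.coe_mk, mul_assoc]
    refine mul_le_mul_of_nonneg_left ?_ hc
    nlinarith [mul_nonneg hm (norm_nonneg V)]
  have hle : ∀ v, ξ v ≤ c * (m + 2) * (1 + ‖V‖) * ‖v‖ := fun v =>
    (hξ v).trans (hL.clarkeDeriv_le_mul_norm (Metric.ball_mem_nhds V one_pos) v)
  refine ξ.opNorm_le_bound hK fun v => ?_
  rw [Real.norm_eq_abs, abs_le]
  have h₁ := hle (-v)
  rw [map_neg, norm_neg] at h₁
  exact ⟨by linarith, hle v⟩

/-- under hypotheses (i)–(iii) on the integrand `φ`, the Clarke subdifferential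
of the integral functional `Φ(t,U) = ∫_X φ(t,x,U(x)) dμ(x)` on `H = L²(X,μ;ℝ²)` satisfies a
linear growth condition: there is `c' > 0` with `‖ξ‖_H ≤ c'(1 + ‖V‖_H)` for every
`ξ ∈ ∂Φ(t,V)` (elements of `H*` being identified with `H`, the identification being
norm-preserving). -/
theorem stmt15 {X : Type*} [MeasurableSpace X] (μ : Measure X) [IsFiniteMeasure μ]
    (T : ℝ) (hT : 0 < T)
    (φ : ℝ → X → EuclideanSpace ℝ (Fin 2) → ℝ)
    (h_meas : ∀ t ∈ Set.Ioo (0 : ℝ) T, ∀ ξ : EuclideanSpace ℝ (Fin 2),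
      Measurable (fun x : X => φ t x ξ))
    (h_zero : ∀ t ∈ Set.Ioo (0 : ℝ) T, Integrable (fun x : X => φ t x 0) μ)
    (h_lip : ∀ t ∈ Set.Ioo (0 : ℝ) T, ∀ x : X, LocallyLipschitz (φ t x))
    (c : ℝ) (hc : 0 < c)
    (h_growth : ∀ t ∈ Set.Ioo (0 : ℝ) T, ∀ (x : X) (ξ : EuclideanSpace ℝ (Fin 2)),
      ∀ ν ∈ clarkeSubdiff (φ t x) ξ, ‖ν‖ ≤ c * (1 + ‖ξ‖)) :
    ∃ c' : ℝ, 0 < c' ∧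
      ∀ t ∈ Set.Ioo (0 : ℝ) T, ∀ V : Lp (EuclideanSpace ℝ (Fin 2)) 2 μ,
        ∀ ξ ∈ clarkeSubdiff
            (fun U : Lp (EuclideanSpace ℝ (Fin 2)) 2 μ => ∫ x, φ t x (U x) ∂μ) V,
          ‖ξ‖ ≤ c' * (1 + ‖V‖) := by
  refine ⟨c * (‖Lp.const 2 μ (1 : ℝ)‖ + 2), by positivity, fun t ht V ξ hξ => ?_⟩
  exact norm_le_of_mem_clarkeSubdiff hc.le (norm_nonneg _)
    (abs_integral_comp_sub_le hc.le (h_meas t ht) (h_zero t ht)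
      (fun x => (h_lip t ht x).continuous)
      fun x => (h_lip t ht x).abs_sub_le_of_clarkeSubdiff_growth hc.le (h_growth t ht x)) hξ
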